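/- Let A be a real symmetric positive definite 2×2 matrix with eigenvalues 0 < λ1 ≤ λ2, let k > 0, and let 0 < L < √(2kλ1)/λ2. Then the Lebesgue measure of Ẽ_{A,k} ∖ G̃_{L,A,k} = {x ∈ Ẽ_{A,k} : dist(x, ∂Ẽ_{A,k}) < L} equals L·C_E − πL². -/

import Mathlib

open Matrix

/-!
STATEMENT 10: Let `A` be a real symmetric positive definite 2×2 matrix with eigenvalues
`0 < λ1 ≤ λ2`, `k > 0`, and `0 < L < √(2kλ1)/λ2` (the minimal radius of curvature of the
ellipse `∂Ẽ_{A,k}`).  Then the Lebesgue measure of the inner collar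
`Ẽ_{A,k} ∖ G̃_{L,A,k} = {x ∈ Ẽ_{A,k} : dist(x, ∂Ẽ_{A,k}) < L}` equals `L·C_E − πL²`,
where `C_E` is the circumference of the ellipse.
-/

/-- The quadratic form `q_A(x) = (1/2)xᵀAx`. -/
noncomputable def qA (A : Matrix (Fin 2) (Fin 2) ℝ) (x : EuclideanSpace ℝ (Fin 2)) : ℝ :=
  (1 / 2) * ((WithLp.equiv 2 (Fin 2 → ℝ) x) ⬝ᵥ A.mulVec (WithLp.equiv 2 (Fin 2 → ℝ) x))

/-- The open continuum ellipse `Ẽ_{A,k}`. -/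
noncomputable def Etilde (A : Matrix (Fin 2) (Fin 2) ℝ) (k : ℝ) :
    Set (EuclideanSpace ℝ (Fin 2)) := {x | qA A x < k}

/-- The circumference of the ellipse with semi-axes `r₁ = √(2k/λ1)` and `r₂ = √(2k/λ2)`. -/
noncomputable def circEllipse (l1 l2 k : ℝ) : ℝ :=
  ∫ t in (0 : ℝ)..(2 * Real.pi),
    Real.sqrt (2 * k / l1 * Real.sin t ^ 2 + 2 * k / l2 * Real.cos t ^ 2)

open Real Set MeasureTheory

/-- The support function of the ellipse `x² / a² + y² / b² = 1` in the direction of angle `θ`. -/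
noncomputable def ellipseSupport (a b θ : ℝ) : ℝ := √(a ^ 2 * cos θ ^ 2 + b ^ 2 * sin θ ^ 2)

/-- The point at distance `z.2` along the inner normal from the point of the ellipse
`x² / a² + y² / b² = 1` whose outer normal has angle `z.1`. -/
noncomputable def ellipseParallel (a b : ℝ) (z : ℝ × ℝ) : ℝ × ℝ :=
  ((a ^ 2 / ellipseSupport a b z.1 - z.2) * cos z.1,
    (b ^ 2 / ellipseSupport a b z.1 - z.2) * sin z.1)

lemma ellipseSupport_sq (a b θ : ℝ) :
    ellipseSupport a b θ ^ 2 = a ^ 2 * cos θ ^ 2 + b ^ 2 * sin θ ^ 2 :=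
  sq_sqrt (by positivity)

lemma le_ellipseSupport {a b : ℝ} (hb : 0 < b) (hba : b ≤ a) (θ : ℝ) :
    b ≤ ellipseSupport a b θ := by
  refine le_sqrt_of_sq_le ?_
  have : b ^ 2 ≤ a ^ 2 := by gcongr
  nlinarith [sin_sq_add_cos_sq θ, mul_nonneg (sub_nonneg.2 this) (sq_nonneg (cos θ))]

lemma ellipseSupport_pos {a b : ℝ} (hb : 0 < b) (hba : b ≤ a) (θ : ℝ) :
    0 < ellipseSupport a b θ := hb.trans_le (le_ellipseSupport hb hba θ)

lemma ellipseSupport_le {a b : ℝ} (hb : 0 < b) (hba : b ≤ a) (θ : ℝ) :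
    ellipseSupport a b θ ≤ a := by
  refine sqrt_le_iff.2 ⟨by linarith, ?_⟩
  have : b ^ 2 ≤ a ^ 2 := by gcongr
  nlinarith [sin_sq_add_cos_sq θ, mul_nonneg (sub_nonneg.2 this) (sq_nonneg (sin θ))]

lemma continuous_ellipseSupport (a b : ℝ) : Continuous (ellipseSupport a b) := by
  unfold ellipseSupport; fun_prop

lemma hasDerivAt_ellipseSupport {a b : ℝ} (hb : 0 < b) (hba : b ≤ a) (θ : ℝ) :
    HasDerivAt (ellipseSupport a b)
      ((b ^ 2 - a ^ 2) * sin θ * cos θ / ellipseSupport a b θ) θ := by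
  have h := ellipseSupport_pos hb hba θ
  have h0 : a ^ 2 * cos θ ^ 2 + b ^ 2 * sin θ ^ 2 ≠ 0 := by
    rw [← ellipseSupport_sq]; positivity
  have := ((((hasDerivAt_cos θ).pow 2).const_mul (a ^ 2)).add
    (((hasDerivAt_sin θ).pow 2).const_mul (b ^ 2))).sqrt h0
  refine this.congr_deriv ?_
  change _ / (2 * ellipseSupport a b θ) = _
  field_simp
  simp
  ring

/-- The radius of curvature of an ellipse exceeds its minimal value. -/
lemma lt_curvatureRadius {a b L : ℝ} (hb : 0 < b) (hba : b ≤ a) (hL : a * L < b ^ 2) (θ : ℝ) :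
    L < a ^ 2 * b ^ 2 / ellipseSupport a b θ ^ 3 := by
  have h := ellipseSupport_pos hb hba θ
  have ha : 0 < a := hb.trans_le hba
  calc L < b ^ 2 / a := by rw [lt_div_iff₀ ha]; linarith
    _ = a ^ 2 * b ^ 2 / a ^ 3 := by field_simp
    _ ≤ _ := by gcongr; exact ellipseSupport_le hb hba θ

/-- `h'' = a² b² / h³ - h` for the support function `h` of an ellipse. -/
lemma hasDerivAt_deriv_ellipseSupport {a b : ℝ} (hb : 0 < b) (hba : b ≤ a) (θ : ℝ) :
    HasDerivAt (fun t ↦ (b ^ 2 - a ^ 2) * sin t * cos t / ellipseSupport a b t)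
      (a ^ 2 * b ^ 2 / ellipseSupport a b θ ^ 3 - ellipseSupport a b θ) θ := by
  have h := ellipseSupport_pos hb hba θ
  have h2 := ellipseSupport_sq a b θ
  have := (((hasDerivAt_sin θ).const_mul (b ^ 2 - a ^ 2)).mul (hasDerivAt_cos θ)).div
    (hasDerivAt_ellipseSupport hb hba θ) h.ne'
  refine this.congr_deriv ?_
  simp only [Pi.mul_apply]
  field_simp
  rw [show ellipseSupport a b θ ^ 4 = (ellipseSupport a b θ ^ 2) ^ 2 by ring, h2]
  linear_combination a ^ 2 * b ^ 2 * (1 + sin θ ^ 2 + cos θ ^ 2) * sin_sq_add_cos_sq θ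

lemma continuous_curvatureRadius {a b : ℝ} (hb : 0 < b) (hba : b ≤ a) :
    Continuous fun θ ↦ a ^ 2 * b ^ 2 / ellipseSupport a b θ ^ 3 := by
  refine continuous_const.div ((continuous_ellipseSupport a b).pow 3) fun θ ↦ ?_
  have := ellipseSupport_pos hb hba θ
  positivity

/-- The integral of the radius of curvature over the normal angle is the integral of the
support function. -/
lemma integral_curvatureRadius {a b : ℝ} (hb : 0 < b) (hba : b ≤ a) :
    ∫ θ in (-π)..π, a ^ 2 * b ^ 2 / ellipseSupport a b θ ^ 3 =
      ∫ θ in (-π)..π, ellipseSupport a b θ := by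
  have hc := continuous_curvatureRadius hb hba
  have hd := continuous_ellipseSupport a b
  have := intervalIntegral.integral_eq_sub_of_hasDerivAt
    (fun θ _ ↦ hasDerivAt_deriv_ellipseSupport hb hba θ)
    ((hc.sub hd).intervalIntegrable (-π) π)
  rw [intervalIntegral.integral_sub (hc.intervalIntegrable _ _) (hd.intervalIntegrable _ _)] at this
  simp at this
  linarith

lemma integral_ellipseSupport (a b : ℝ) :
    ∫ θ in (-π)..π, ellipseSupport a b θ =
      ∫ t in (0 : ℝ)..(2 * π), √(a ^ 2 * sin t ^ 2 + b ^ 2 * cos t ^ 2) := by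
  have hp : Function.Periodic (ellipseSupport a b) (2 * π) := fun θ ↦ by simp [ellipseSupport]
  have h1 := hp.intervalIntegral_add_eq (-π) (-(π / 2))
  have h2 := intervalIntegral.integral_comp_sub_right (a := 0) (b := 2 * π)
    (fun t ↦ ellipseSupport a b t) (π / 2)
  rw [show -π + 2 * π = π by ring] at h1
  rw [h1, show -(π / 2) + 2 * π = 2 * π - π / 2 by ring, show -(π / 2) = 0 - π / 2 by ring, ← h2]
  simp [ellipseSupport, cos_sub_pi_div_two, sin_sub_pi_div_two]

/-- The derivative of `ellipseParallel`. -/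
noncomputable def fderivEllipseParallel (a b : ℝ) (z : ℝ × ℝ) : ℝ × ℝ →L[ℝ] ℝ × ℝ :=
  (Matrix.toLin (.finTwoProd ℝ) (.finTwoProd ℝ)
    !![-(a ^ 2 / ellipseSupport a b z.1 - z.2) * sin z.1
        - a ^ 2 * (b ^ 2 - a ^ 2) * sin z.1 * cos z.1 ^ 2 / ellipseSupport a b z.1 ^ 3, -cos z.1;
      (b ^ 2 / ellipseSupport a b z.1 - z.2) * cos z.1
        - b ^ 2 * (b ^ 2 - a ^ 2) * sin z.1 ^ 2 * cos z.1 / ellipseSupport a b z.1 ^ 3,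
      -sin z.1]).toContinuousLinearMap

lemma hasFDerivAt_ellipseParallel {a b : ℝ} (hb : 0 < b) (hba : b ≤ a) (z : ℝ × ℝ) :
    HasFDerivAt (ellipseParallel a b) (fderivEllipseParallel a b z) z := by
  have h := ellipseSupport_pos hb hba z.1
  unfold fderivEllipseParallel
  rw [Matrix.toLin_finTwoProd_toContinuousLinearMap]
  have key (c : ℝ) : HasFDerivAt (fun z : ℝ × ℝ ↦ c ^ 2 / ellipseSupport a b z.1 - z.2) _ z :=
    (((hasDerivAt_const z.1 (c ^ 2)).div
      (hasDerivAt_ellipseSupport hb hba z.1) h.ne').comp_hasFDerivAt z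
      (hasFDerivAt_fst (𝕜 := ℝ))).sub (hasFDerivAt_snd (𝕜 := ℝ))
  refine (((key a).mul ((hasDerivAt_cos z.1).comp_hasFDerivAt z (hasFDerivAt_fst (𝕜 := ℝ)))).prodMk
    ((key b).mul ((hasDerivAt_sin z.1).comp_hasFDerivAt z (hasFDerivAt_fst (𝕜 := ℝ))))).congr_fderiv ?_
  ext <;> simp <;> field_simp <;> ring

lemma det_fderivEllipseParallel {a b : ℝ} (hb : 0 < b) (hba : b ≤ a) (z : ℝ × ℝ) :
    (fderivEllipseParallel a b z).det = a ^ 2 * b ^ 2 / ellipseSupport a b z.1 ^ 3 - z.2 := by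
  have h := ellipseSupport_pos hb hba z.1
  have h2 := ellipseSupport_sq a b z.1
  unfold fderivEllipseParallel
  simp only [LinearMap.det_toContinuousLinearMap, LinearMap.det_toLin, Matrix.det_fin_two_of]
  field_simp
  linear_combination (a ^ 2 * sin z.1 ^ 2 + b ^ 2 * cos z.1 ^ 2) * h2 +
    (a ^ 2 * b ^ 2 * (sin z.1 ^ 2 + cos z.1 ^ 2 + 1) - ellipseSupport a b z.1 ^ 3 * z.2) *
      sin_sq_add_cos_sq z.1

/-- If `p` is the point of the ellipse with normal `(C, S)` and support value `h`, and `x` is at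
distance `s` from `p` along the inner normal, every point `q` of the ellipse is farther from `x`
than `p` is, with a quantitative gap. -/
lemma parallel_dist_sq_ge {a b s h C S q₁ q₂ : ℝ} (hb : 0 < b) (hba : b ≤ a)
    (hh : 0 < h) (hha : h ≤ a) (hs : 0 ≤ s) (hCS : C ^ 2 + S ^ 2 = 1)
    (hh2 : h ^ 2 = a ^ 2 * C ^ 2 + b ^ 2 * S ^ 2)
    (hq : q₁ ^ 2 / a ^ 2 + q₂ ^ 2 / b ^ 2 = 1) :
    s ^ 2 + (1 - s * a / b ^ 2) * ((a ^ 2 * C / h - q₁) ^ 2 + (b ^ 2 * S / h - q₂) ^ 2) ≤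
      ((a ^ 2 / h - s) * C - q₁) ^ 2 + ((b ^ 2 / h - s) * S - q₂) ^ 2 := by
  have ha : 0 < a := hb.trans_le hba
  set p₁ := a ^ 2 * C / h with hp₁
  set p₂ := b ^ 2 * S / h with hp₂
  have hC : C = h * p₁ / a ^ 2 := by rw [hp₁]; field_simp
  have hS : S = h * p₂ / b ^ 2 := by rw [hp₂]; field_simp
  have hp : p₁ ^ 2 / a ^ 2 + p₂ ^ 2 / b ^ 2 = 1 := by
    rw [hp₁, hp₂]; field_simp; linarith
  have e₁ : (a ^ 2 / h - s) * C = p₁ - s * C := by rw [hp₁]; ring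
  have e₂ : (b ^ 2 / h - s) * S = p₂ - s * S := by rw [hp₂]; ring
  have hn : C * (p₁ - q₁) + S * (p₂ - q₂) =
      h / 2 * ((p₁ - q₁) ^ 2 / a ^ 2 + (p₂ - q₂) ^ 2 / b ^ 2) := by
    rw [hC, hS]
    linear_combination h / 2 * hp - h / 2 * hq
  have hle : (p₁ - q₁) ^ 2 / a ^ 2 ≤ (p₁ - q₁) ^ 2 / b ^ 2 := by gcongr
  have hle2 : h / 2 * ((p₁ - q₁) ^ 2 / a ^ 2 + (p₂ - q₂) ^ 2 / b ^ 2) ≤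
      a / 2 * ((p₁ - q₁) ^ 2 / b ^ 2 + (p₂ - q₂) ^ 2 / b ^ 2) := by gcongr
  have hle3 : s * (C * (p₁ - q₁) + S * (p₂ - q₂)) ≤
      s * (a / 2 * ((p₁ - q₁) ^ 2 / b ^ 2 + (p₂ - q₂) ^ 2 / b ^ 2)) := by
    rw [hn]; gcongr
  rw [e₁, e₂]
  have e₃ : (1 - s * a / b ^ 2) * ((p₁ - q₁) ^ 2 + (p₂ - q₂) ^ 2) = (p₁ - q₁) ^ 2 + (p₂ - q₂) ^ 2
      - 2 * (s * (a / 2 * ((p₁ - q₁) ^ 2 / b ^ 2 + (p₂ - q₂) ^ 2 / b ^ 2))) := by ring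
  rw [e₃]
  linear_combination 2 * hle3 - s ^ 2 * hCS

/-- Inner parallel points of an ellipse at distance less than `b² / a` are inside. -/
lemma parallel_mem_interior {a b s h C S : ℝ} (hb : 0 < b) (hba : b ≤ a)
    (hh : 0 < h) (hha : h ≤ a) (hs : 0 < s) (hsb : a * s < b ^ 2) (hCS : C ^ 2 + S ^ 2 = 1)
    (hh2 : h ^ 2 = a ^ 2 * C ^ 2 + b ^ 2 * S ^ 2) :
    ((a ^ 2 / h - s) * C) ^ 2 / a ^ 2 + ((b ^ 2 / h - s) * S) ^ 2 / b ^ 2 < 1 := by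
  have ha : 0 < a := hb.trans_le hba
  have h1 : C ^ 2 / a ^ 2 + S ^ 2 / b ^ 2 ≤ 1 / b ^ 2 := by
    rw [← hCS, add_div]; gcongr
  have h2 : s / b ^ 2 < 1 / h := by
    rw [div_lt_div_iff₀ (by positivity) hh]
    nlinarith
  have h3 : s * (s * (C ^ 2 / a ^ 2 + S ^ 2 / b ^ 2)) ≤ s * (s * (1 / b ^ 2)) := by gcongr
  have h4 : s * (s / b ^ 2) < s * (1 / h) := by gcongr
  have h5 : 0 < s * (1 / h) := by positivity
  have e : ((a ^ 2 / h - s) * C) ^ 2 / a ^ 2 + ((b ^ 2 / h - s) * S) ^ 2 / b ^ 2 =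
      1 - 2 * (s * (1 / h)) + s * (s * (C ^ 2 / a ^ 2 + S ^ 2 / b ^ 2)) := by
    field_simp
    linear_combination (-a ^ 2 * b ^ 2) * hh2 - 2 * s * h * a ^ 2 * b ^ 2 * hCS
  rw [e]
  have : s * (s * (1 / b ^ 2)) = s * (s / b ^ 2) := by ring
  linarith

/-- A point `x` inside the ellipse which differs from a point `p` of the ellipse by a normal vector
is the inner parallel point of `p` at distance `|x - p|`. -/
lemma exists_parallel_eq {a b x₁ x₂ p₁ p₂ : ℝ} (ha : 0 < a) (hb : 0 < b)
    (hp : p₁ ^ 2 / a ^ 2 + p₂ ^ 2 / b ^ 2 = 1) (hx : x₁ ^ 2 / a ^ 2 + x₂ ^ 2 / b ^ 2 < 1)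
    (hn : (x₁ - p₁) * (a / b * p₂) = (x₂ - p₂) * (b / a * p₁)) :
    ∃ C S s : ℝ, C ^ 2 + S ^ 2 = 1 ∧ 0 < s ∧ s ^ 2 = (x₁ - p₁) ^ 2 + (x₂ - p₂) ^ 2 ∧
      x₁ = (a ^ 2 / √(a ^ 2 * C ^ 2 + b ^ 2 * S ^ 2) - s) * C ∧
      x₂ = (b ^ 2 / √(a ^ 2 * C ^ 2 + b ^ 2 * S ^ 2) - s) * S := by
  set g := √(p₁ ^ 2 / a ^ 4 + p₂ ^ 2 / b ^ 4) with hg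
  have hg0 : 0 < p₁ ^ 2 / a ^ 4 + p₂ ^ 2 / b ^ 4 := by
    rcases eq_or_ne p₁ 0 with h | h
    · have : p₂ ≠ 0 := by rintro rfl; simp [h] at hp
      positivity
    · positivity
  have hgpos : 0 < g := sqrt_pos.2 hg0
  have hg2 : g ^ 2 = p₁ ^ 2 / a ^ 4 + p₂ ^ 2 / b ^ 4 := sq_sqrt hg0.le
  obtain ⟨C, hC⟩ : ∃ C, C = p₁ / (a ^ 2 * g) := ⟨_, rfl⟩
  obtain ⟨S, hS⟩ : ∃ S, S = p₂ / (b ^ 2 * g) := ⟨_, rfl⟩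
  have hCp : p₁ = C * (a ^ 2 * g) := by rw [hC]; field_simp
  have hSp : p₂ = S * (b ^ 2 * g) := by rw [hS]; field_simp
  have hCS : C ^ 2 + S ^ 2 = 1 := by
    have : (C ^ 2 + S ^ 2) * g ^ 2 = 1 * g ^ 2 := by
      conv_rhs => rw [hg2]
      rw [hC, hS]; field_simp
    exact mul_right_cancel₀ (by positivity) this
  have hh : √(a ^ 2 * C ^ 2 + b ^ 2 * S ^ 2) = 1 / g := by
    rw [show a ^ 2 * C ^ 2 + b ^ 2 * S ^ 2 = (1 / g) ^ 2 from ?_, sqrt_sq (by positivity)]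
    rw [hCp, hSp] at hp
    field_simp at hp ⊢
    linarith
  have hn' : (x₁ - p₁) * S = (x₂ - p₂) * C := by
    have : (x₁ - p₁) * S * (a * b * g) = (x₂ - p₂) * C * (a * b * g) := by
      rw [hC, hS]; field_simp at hn ⊢; linarith
    exact mul_right_cancel₀ (by positivity) this
  obtain ⟨s, hs⟩ : ∃ s, s = -((x₁ - p₁) * C + (x₂ - p₂) * S) := ⟨_, rfl⟩
  have hx₁ : x₁ = p₁ - s * C := by
    rw [hs]; linear_combination (-(x₁ - p₁)) * hCS + S * hn'
  have hx₂ : x₂ = p₂ - s * S := by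
    rw [hs]; linear_combination (-(x₂ - p₂)) * hCS - C * hn'
  refine ⟨C, S, s, hCS, ?_, ?_, ?_, ?_⟩
  · by_contra! hs0
    have e : x₁ ^ 2 / a ^ 2 + x₂ ^ 2 / b ^ 2 = p₁ ^ 2 / a ^ 2 + p₂ ^ 2 / b ^ 2
        + 2 * (-s * g * (C ^ 2 + S ^ 2)) + (s * C / a) ^ 2 + (s * S / b) ^ 2 := by
      rw [hx₁, hx₂, hCp, hSp]; field_simp; ring
    have : 0 ≤ -s * g * (C ^ 2 + S ^ 2) :=
      mul_nonneg (mul_nonneg (by linarith) hgpos.le) (by positivity)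
    nlinarith [sq_nonneg (s * C / a), sq_nonneg (s * S / b)]
  · rw [hx₁, hx₂]; linear_combination (-s ^ 2) * hCS
  · rw [hh, hx₁, hCp]; field_simp
  · rw [hh, hx₂, hSp]; field_simp

lemma exists_mem_Ioc_cos_sin {C S : ℝ} (h : C ^ 2 + S ^ 2 = 1) :
    ∃ θ ∈ Ioc (-π) π, cos θ = C ∧ sin θ = S := by
  have hn : ‖(⟨C, S⟩ : ℂ)‖ = 1 := by
    rw [Complex.norm_def, Complex.normSq_mk, ← sq, ← sq, h, sqrt_one]
  refine ⟨Complex.arg ⟨C, S⟩, Complex.arg_mem_Ioc _, ?_, ?_⟩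
  · rw [Complex.cos_arg (norm_ne_zero_iff.1 (by simp [hn])), hn, div_one]
  · rw [Complex.sin_arg, hn, div_one]

lemma eq_of_mem_Ioc_of_cos_eq_of_sin_eq {θ φ : ℝ} (hθ : θ ∈ Ioc (-π) π) (hφ : φ ∈ Ioc (-π) π)
    (hc : cos θ = cos φ) (hs : sin θ = sin φ) : θ = φ := by
  rw [← Complex.arg_cos_add_sin_mul_I hθ, ← Complex.arg_cos_add_sin_mul_I hφ,
    ← Complex.ofReal_cos, ← Complex.ofReal_cos, ← Complex.ofReal_sin, ← Complex.ofReal_sin, hc, hs]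

lemma ellipse_normal_point {a b h C S : ℝ} (ha : a ≠ 0) (hb : b ≠ 0) (hh : 0 < h)
    (hh2 : h ^ 2 = a ^ 2 * C ^ 2 + b ^ 2 * S ^ 2) :
    (a ^ 2 * C / h) ^ 2 / a ^ 2 + (b ^ 2 * S / h) ^ 2 / b ^ 2 = 1 := by
  field_simp; linarith

lemma injOn_ellipseParallel {a b L : ℝ} (hb : 0 < b) (hba : b ≤ a) (hL : a * L < b ^ 2) :
    InjOn (ellipseParallel a b) (Ioc (-π) π ×ˢ Ioo 0 L) := by
  have ha : 0 < a := hb.trans_le hba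
  rintro ⟨θ, s⟩ ⟨hθ, hs0, hsL⟩ ⟨φ, t⟩ ⟨hφ, ht0, htL⟩ h
  simp only [ellipseParallel, Prod.mk.injEq] at h hθ hφ hs0 hsL ht0 htL
  obtain ⟨h₁, h₂⟩ := h
  have gap {r : ℝ} (hr : r < L) : 0 < 1 - r * a / b ^ 2 := by
    rw [sub_pos, div_lt_one (by positivity)]
    nlinarith
  have A := parallel_dist_sq_ge hb hba (ellipseSupport_pos hb hba θ) (ellipseSupport_le hb hba θ)
    hs0.le (cos_sq_add_sin_sq θ) (ellipseSupport_sq a b θ)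
    (ellipse_normal_point ha.ne' hb.ne' (ellipseSupport_pos hb hba φ) (ellipseSupport_sq a b φ))
  have B := parallel_dist_sq_ge hb hba (ellipseSupport_pos hb hba φ) (ellipseSupport_le hb hba φ)
    ht0.le (cos_sq_add_sin_sq φ) (ellipseSupport_sq a b φ)
    (ellipse_normal_point ha.ne' hb.ne' (ellipseSupport_pos hb hba θ) (ellipseSupport_sq a b θ))
  rw [h₁, h₂] at A
  rw [← h₁, ← h₂] at B
  have eA : ((a ^ 2 / ellipseSupport a b φ - t) * cos φ - a ^ 2 * cos φ / ellipseSupport a b φ) ^ 2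
      + ((b ^ 2 / ellipseSupport a b φ - t) * sin φ - b ^ 2 * sin φ / ellipseSupport a b φ) ^ 2
      = t ^ 2 := by
    linear_combination t ^ 2 * cos_sq_add_sin_sq φ
  have eB : ((a ^ 2 / ellipseSupport a b θ - s) * cos θ - a ^ 2 * cos θ / ellipseSupport a b θ) ^ 2
      + ((b ^ 2 / ellipseSupport a b θ - s) * sin θ - b ^ 2 * sin θ / ellipseSupport a b θ) ^ 2
      = s ^ 2 := by
    linear_combination s ^ 2 * cos_sq_add_sin_sq θ
  rw [eA] at A
  rw [eB] at B
  obtain ⟨u, hu⟩ : ∃ u, u = a ^ 2 * cos θ / ellipseSupport a b θ - a ^ 2 * cos φ / ellipseSupport a b φ :=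
    ⟨_, rfl⟩
  obtain ⟨v, hv⟩ : ∃ v, v = b ^ 2 * sin θ / ellipseSupport a b θ - b ^ 2 * sin φ / ellipseSupport a b φ :=
    ⟨_, rfl⟩
  rw [← hu, ← hv] at A
  have B' : t ^ 2 + (1 - t * a / b ^ 2) * (u ^ 2 + v ^ 2) ≤ s ^ 2 := by
    convert B using 3; rw [hu, hv]; ring
  have hst : (1 - s * a / b ^ 2 + (1 - t * a / b ^ 2)) * (u ^ 2 + v ^ 2) ≤ 0 := by linarith
  have huv : u ^ 2 + v ^ 2 = 0 := le_antisymm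
    (nonpos_of_mul_nonpos_right hst (by linarith [gap hsL, gap htL])) (by positivity)
  have hu0 : u = 0 := pow_eq_zero_iff two_ne_zero |>.1 (by linarith [sq_nonneg u, sq_nonneg v])
  have hv0 : v = 0 := pow_eq_zero_iff two_ne_zero |>.1 (by linarith [sq_nonneg u, sq_nonneg v])
  rw [huv] at A B'
  have hst : s = t := by
    refine (sq_eq_sq₀ hs0.le ht0.le).1 (by linarith)
  subst hst
  have hc : cos θ = cos φ := mul_left_cancel₀ hs0.ne' (by
    linear_combination hu0 - hu - h₁)
  have hsn : sin θ = sin φ := mul_left_cancel₀ hs0.ne' (by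
    linear_combination hv0 - hv - h₂)
  rw [eq_of_mem_Ioc_of_cos_eq_of_sin_eq hθ hφ hc hsn]

lemma volume_image_ellipseParallel {a b L : ℝ} (hb : 0 < b) (hba : b ≤ a) (hL0 : 0 < L)
    (hL : a * L < b ^ 2) :
    (volume (ellipseParallel a b '' (Ioc (-π) π ×ˢ Ioo 0 L))).toReal =
      L * (∫ t in (0 : ℝ)..(2 * π), √(a ^ 2 * sin t ^ 2 + b ^ 2 * cos t ^ 2)) - π * L ^ 2 := by
  have hms : MeasurableSet (Ioc (-π) π ×ˢ Ioo 0 L) := measurableSet_Ioc.prod measurableSet_Ioo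
  have hcR := continuous_curvatureRadius hb hba
  have hcont : Continuous fun z : ℝ × ℝ ↦
      a ^ 2 * b ^ 2 / ellipseSupport a b z.1 ^ 3 - z.2 :=
    (hcR.comp continuous_fst).sub continuous_snd
  have hint : IntegrableOn (fun z : ℝ × ℝ ↦ a ^ 2 * b ^ 2 / ellipseSupport a b z.1 ^ 3 - z.2)
      (Ioc (-π) π ×ˢ Ioo 0 L) volume :=
    (hcont.continuousOn.integrableOn_compact (isCompact_Icc.prod isCompact_Icc)).mono_set
      (prod_mono Ioc_subset_Icc_self Ioo_subset_Icc_self)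
  have hpos : ∀ z ∈ Ioc (-π) π ×ˢ Ioo 0 L,
      0 ≤ a ^ 2 * b ^ 2 / ellipseSupport a b z.1 ^ 3 - z.2 := fun z hz ↦ by
    have := lt_curvatureRadius hb hba hL z.1
    linarith [hz.2.2]
  rw [← lintegral_abs_det_fderiv_eq_addHaar_image volume hms
    (fun z _ ↦ (hasFDerivAt_ellipseParallel hb hba z).hasFDerivWithinAt)
    (injOn_ellipseParallel hb hba hL)]
  rw [setLIntegral_congr_fun (g := fun z ↦ ENNReal.ofReal
    (a ^ 2 * b ^ 2 / ellipseSupport a b z.1 ^ 3 - z.2)) hms fun z hz ↦ by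
      rw [det_fderivEllipseParallel hb hba, abs_of_nonneg (hpos z hz)],
    ← ofReal_integral_eq_lintegral_ofReal hint
      ((ae_restrict_iff' hms).2 (.of_forall hpos)),
    ENNReal.toReal_ofReal (setIntegral_nonneg hms hpos),
    Measure.volume_eq_prod, setIntegral_prod _ (by rwa [← Measure.volume_eq_prod])]
  have inner (c : ℝ) : ∫ s in Ioo 0 L, (c - s) = L * c - L ^ 2 / 2 := by
    rw [← integral_Ioc_eq_integral_Ioo, ← intervalIntegral.integral_of_le hL0.le,
      intervalIntegral.integral_sub (by simp) (by simp)]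
    simp
  simp only [inner]
  rw [← intervalIntegral.integral_of_le (by linarith [pi_pos]),
    intervalIntegral.integral_sub ((hcR.const_mul L).intervalIntegrable _ _) (by simp),
    intervalIntegral.integral_const_mul, integral_curvatureRadius hb hba, integral_ellipseSupport]
  simp
  ring

lemma continuous_ellipseForm (a b : ℝ) :
    Continuous fun x : EuclideanSpace ℝ (Fin 2) ↦ x 0 ^ 2 / a ^ 2 + x 1 ^ 2 / b ^ 2 := by
  fun_prop

lemma frontier_ellipse (a b : ℝ) :
    frontier {x : EuclideanSpace ℝ (Fin 2) | x 0 ^ 2 / a ^ 2 + x 1 ^ 2 / b ^ 2 < 1} =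
      {x | x 0 ^ 2 / a ^ 2 + x 1 ^ 2 / b ^ 2 = 1} := by
  have hc := continuous_ellipseForm a b
  refine (frontier_lt_subset_eq hc continuous_const).antisymm fun x hx ↦ ?_
  rw [(isOpen_lt hc continuous_const).frontier_eq]
  refine ⟨?_, fun h ↦ (ne_of_lt h) hx⟩
  have ht : Filter.Tendsto (fun r : ℝ ↦ r • x) (nhdsWithin 1 (Ioo 0 1)) (nhds x) := by
    have : Continuous fun r : ℝ ↦ r • x := by fun_prop
    simpa using (this.tendsto 1).mono_left nhdsWithin_le_nhds
  have : (nhdsWithin (1 : ℝ) (Ioo 0 1)).NeBot := right_nhdsWithin_Ioo_neBot one_pos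
  refine mem_closure_of_tendsto ht (eventually_nhdsWithin_of_forall fun r hr ↦ ?_)
  have hx : x 0 ^ 2 / a ^ 2 + x 1 ^ 2 / b ^ 2 = 1 := hx
  change (r * x 0) ^ 2 / a ^ 2 + (r * x 1) ^ 2 / b ^ 2 < 1
  calc _ = r ^ 2 * (x 0 ^ 2 / a ^ 2 + x 1 ^ 2 / b ^ 2) := by ring
    _ < 1 := by rw [hx, mul_one]; exact pow_lt_one₀ hr.1.le hr.2 two_ne_zero

lemma dist_sq_fin_two (x y : EuclideanSpace ℝ (Fin 2)) :
    dist x y ^ 2 = (x 0 - y 0) ^ 2 + (x 1 - y 1) ^ 2 := by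
  rw [EuclideanSpace.dist_eq, sq_sqrt (by positivity), Fin.sum_univ_two, Real.dist_eq,
    Real.dist_eq, sq_abs, sq_abs]

/-- The segment from a point to a nearest point of an ellipse is normal to the ellipse. -/
lemma normal_of_forall_dist_le {a b : ℝ} (ha : a ≠ 0) (hb : b ≠ 0)
    {x p : EuclideanSpace ℝ (Fin 2)} (hp : p 0 ^ 2 / a ^ 2 + p 1 ^ 2 / b ^ 2 = 1)
    (hmin : ∀ q : EuclideanSpace ℝ (Fin 2), q 0 ^ 2 / a ^ 2 + q 1 ^ 2 / b ^ 2 = 1 →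
      dist x p ≤ dist x q) :
    (x 0 - p 0) * (a / b * p 1) = (x 1 - p 1) * (b / a * p 0) := by
  let f : ℝ → ℝ := fun t ↦ (x 0 - (cos t * p 0 - sin t * (a / b * p 1))) ^ 2 +
    (x 1 - (cos t * p 1 + sin t * (b / a * p 0))) ^ 2
  have hf : IsLocalMin f 0 := .of_forall fun t ↦ by
    have := hmin !₂[cos t * p 0 - sin t * (a / b * p 1), cos t * p 1 + sin t * (b / a * p 0)] (by
      simp only [Matrix.cons_val_zero, Matrix.cons_val_one]
      rw [← hp]
      field_simp
      linear_combination (p 0 ^ 2 * b ^ 2 + p 1 ^ 2 * a ^ 2) * cos_sq_add_sin_sq t)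
    have := pow_le_pow_left₀ dist_nonneg this 2
    simpa [f, dist_sq_fin_two] using this
  have hd : HasDerivAt f _ 0 :=
    (((hasDerivAt_const 0 (x 0)).sub (((hasDerivAt_cos 0).mul_const (p 0)).sub
      ((hasDerivAt_sin 0).mul_const (a / b * p 1)))).pow 2).add
    (((hasDerivAt_const 0 (x 1)).sub (((hasDerivAt_cos 0).mul_const (p 1)).add
      ((hasDerivAt_sin 0).mul_const (b / a * p 0)))).pow 2)
  have := hf.hasDerivAt_eq_zero hd
  simp at this
  linarith

/-- The inner collar of an ellipse is the image of `ellipseParallel`. -/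
lemma mem_collar_iff {a b L : ℝ} (hb : 0 < b) (hba : b ≤ a) (hL : a * L < b ^ 2)
    (x : EuclideanSpace ℝ (Fin 2)) :
    (x 0 ^ 2 / a ^ 2 + x 1 ^ 2 / b ^ 2 < 1 ∧ Metric.infDist x
      {y : EuclideanSpace ℝ (Fin 2) | y 0 ^ 2 / a ^ 2 + y 1 ^ 2 / b ^ 2 = 1} < L) ↔
      (x 0, x 1) ∈ ellipseParallel a b '' (Ioc (-π) π ×ˢ Ioo 0 L) := by
  have ha : 0 < a := hb.trans_le hba
  constructor
  · rintro ⟨hx, hd⟩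
    obtain ⟨p, hp, hpd⟩ := (isClosed_eq (continuous_ellipseForm a b)
      continuous_const).exists_infDist_eq_dist (⟨!₂[a, 0], by simp [ha.ne']⟩ :
        {y : EuclideanSpace ℝ (Fin 2) | y 0 ^ 2 / a ^ 2 + y 1 ^ 2 / b ^ 2 = 1}.Nonempty) x
    have hn := normal_of_forall_dist_le ha.ne' hb.ne' hp fun q hq ↦
      hpd.symm.trans_le (Metric.infDist_le_dist_of_mem hq)
    obtain ⟨C, S, s, hCS, hs, hs2, h₁, h₂⟩ := exists_parallel_eq ha hb hp hx hn
    obtain ⟨θ, hθ, rfl, rfl⟩ := exists_mem_Ioc_cos_sin hCS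
    rw [← dist_sq_fin_two, sq_eq_sq₀ hs.le dist_nonneg] at hs2
    exact ⟨(θ, s), ⟨hθ, hs, by rwa [hs2, ← hpd]⟩, Prod.ext h₁.symm h₂.symm⟩
  · rintro ⟨⟨θ, s⟩, ⟨-, hs0, hsL⟩, h⟩
    simp only [ellipseParallel, Prod.mk.injEq] at h hs0 hsL
    have hh := ellipseSupport_pos hb hba θ
    have hh2 := ellipseSupport_sq a b θ
    refine ⟨?_, ?_⟩
    · rw [← h.1, ← h.2]
      exact parallel_mem_interior hb hba hh (ellipseSupport_le hb hba θ) hs0 (by nlinarith)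
        (cos_sq_add_sin_sq θ) hh2
    · refine lt_of_le_of_lt (Metric.infDist_le_dist_of_mem
        (y := !₂[a ^ 2 * cos θ / ellipseSupport a b θ, b ^ 2 * sin θ / ellipseSupport a b θ])
        (ellipse_normal_point ha.ne' hb.ne' hh hh2)) ?_
      refine lt_of_pow_lt_pow_left₀ 2 (hs0.trans hsL).le ?_
      rw [dist_sq_fin_two, ← h.1, ← h.2]
      simp only [Matrix.cons_val_zero, Matrix.cons_val_one]
      calc _ = s ^ 2 := by linear_combination s ^ 2 * cos_sq_add_sin_sq θ
        _ < _ := by gcongr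

lemma volume_ellipse_collar {a b L : ℝ} (hb : 0 < b) (hba : b ≤ a) (hL0 : 0 < L)
    (hL : a * L < b ^ 2) :
    (volume {x : EuclideanSpace ℝ (Fin 2) | x 0 ^ 2 / a ^ 2 + x 1 ^ 2 / b ^ 2 < 1 ∧
      Metric.infDist x
        {y : EuclideanSpace ℝ (Fin 2) | y 0 ^ 2 / a ^ 2 + y 1 ^ 2 / b ^ 2 = 1} < L}).toReal =
      L * (∫ t in (0 : ℝ)..(2 * π), √(a ^ 2 * sin t ^ 2 + b ^ 2 * cos t ^ 2)) - π * L ^ 2 := by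
  rw [← volume_image_ellipseParallel hb hba hL0 hL]
  simp only [mem_collar_iff hb hba hL]
  let e := (MeasurableEquiv.toLp 2 (Fin 2 → ℝ)).symm.trans MeasurableEquiv.finTwoArrow
  have he : MeasurePreserving e volume volume :=
    (volume_preserving_finTwoArrow ℝ).comp
      (EuclideanSpace.volume_preserving_symm_measurableEquiv_toLp (Fin 2))
  rw [← he.measure_preimage_equiv]
  rfl

/-- A symmetric `2 × 2` matrix is diagonalised by a rotation. -/
lemma exists_rotation_diagonalizing {A : Matrix (Fin 2) (Fin 2) ℝ} (hA : A.IsSymm) {l1 l2 : ℝ}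
    (htr : A.trace = l1 + l2) (hdet : A.det = l1 * l2) :
    ∃ c s : ℝ, c ^ 2 + s ^ 2 = 1 ∧ A 0 0 = l1 * c ^ 2 + l2 * s ^ 2 ∧
      A 0 1 = (l1 - l2) * (c * s) ∧ A 1 0 = (l1 - l2) * (c * s) ∧
      A 1 1 = l1 * s ^ 2 + l2 * c ^ 2 := by
  have h10 : A 1 0 = A 0 1 := hA.apply 0 1
  rw [Matrix.trace_fin_two] at htr
  rw [Matrix.det_fin_two, h10] at hdet
  rw [h10]
  have hdisc : (A 0 0 - A 1 1) ^ 2 + (2 * A 0 1) ^ 2 = (l1 - l2) ^ 2 := by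
    linear_combination (A 0 0 + A 1 1 + l1 + l2) * htr - 4 * hdet
  rcases eq_or_ne l1 l2 with rfl | hne
  · have h1 : A 0 0 - A 1 1 = 0 := by nlinarith [sq_nonneg (A 0 0 - A 1 1), sq_nonneg (2 * A 0 1)]
    have h2 : A 0 1 = 0 := by nlinarith [sq_nonneg (A 0 0 - A 1 1), sq_nonneg (2 * A 0 1)]
    exact ⟨1, 0, by norm_num, by linarith, by linarith, by linarith, by linarith⟩
  · have hne' : l1 - l2 ≠ 0 := sub_ne_zero.2 hne
    obtain ⟨θ, -, hc, hs⟩ := exists_mem_Ioc_cos_sin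
      (C := (A 0 0 - A 1 1) / (l1 - l2)) (S := 2 * A 0 1 / (l1 - l2)) (by
        rw [div_pow, div_pow, ← add_div, hdisc, div_self (by positivity)])
    rw [eq_div_iff hne'] at hc hs
    rw [show θ = 2 * (θ / 2) by ring, cos_two_mul] at hc
    rw [show θ = 2 * (θ / 2) by ring, sin_two_mul] at hs
    have h1 := cos_sq_add_sin_sq (θ / 2)
    refine ⟨cos (θ / 2), sin (θ / 2), h1, ?_, ?_, ?_, ?_⟩
    · linear_combination htr / 2 - hc / 2 - l2 * h1
    · linear_combination -hs / 2
    · linear_combination -hs / 2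
    · linear_combination htr / 2 + hc / 2 - l1 * h1

/-- The rotation of the plane with cosine `c` and sine `s`. -/
noncomputable def planeRotation (c s : ℝ) (h : c ^ 2 + s ^ 2 = 1) :
    EuclideanSpace ℝ (Fin 2) ≃ₗᵢ[ℝ] EuclideanSpace ℝ (Fin 2) :=
  LinearIsometry.toLinearIsometryEquiv
    { toFun := fun x ↦ !₂[c * x 0 - s * x 1, s * x 0 + c * x 1]
      map_add' := fun x y ↦ by ext i; fin_cases i <;> simp <;> ring
      map_smul' := fun r x ↦ by ext i; fin_cases i <;> simp <;> ring
      norm_map' := fun x ↦ by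
        simp only [EuclideanSpace.norm_eq, Fin.sum_univ_two, Real.norm_eq_abs, sq_abs]
        congr 1
        simp
        linear_combination (x 0 ^ 2 + x 1 ^ 2) * h } rfl

lemma planeRotation_apply (c s : ℝ) (h : c ^ 2 + s ^ 2 = 1) (x : EuclideanSpace ℝ (Fin 2)) :
    planeRotation c s h x = !₂[c * x 0 - s * x 1, s * x 0 + c * x 1] := rfl

theorem collar_area (A : Matrix (Fin 2) (Fin 2) ℝ)
    (hA : A.IsSymm) (hApd : A.PosDef) (l1 l2 : ℝ)
    (hl1 : 0 < l1) (hl12 : l1 ≤ l2)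
    (htr : A.trace = l1 + l2) (hdet : A.det = l1 * l2)
    (k L : ℝ) (hk : 0 < k) (hL : 0 < L) (hLlt : L < Real.sqrt (2 * k * l1) / l2) :
    (MeasureTheory.volume
        {x ∈ Etilde A k | Metric.infDist x (frontier (Etilde A k)) < L}).toReal =
      L * circEllipse l1 l2 k - Real.pi * L ^ 2 := by
  have hl2 : 0 < l2 := hl1.trans_le hl12
  obtain ⟨c, s, hcs, h00, h01, h10, h11⟩ := exists_rotation_diagonalizing hA htr hdet
  have ha2 : √(2 * k / l1) ^ 2 = 2 * k / l1 := sq_sqrt (by positivity)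
  have hb2 : √(2 * k / l2) ^ 2 = 2 * k / l2 := sq_sqrt (by positivity)
  have hb : 0 < √(2 * k / l2) := sqrt_pos.2 (by positivity)
  have hba : √(2 * k / l2) ≤ √(2 * k / l1) := by gcongr
  have hab : √(2 * k / l1) * L < √(2 * k / l2) ^ 2 := by
    calc √(2 * k / l1) * L < √(2 * k / l1) * (√(2 * k * l1) / l2) := by gcongr
      _ = 2 * k / l2 := by
        rw [← mul_div_assoc, ← sqrt_mul (by positivity),
          show 2 * k / l1 * (2 * k * l1) = (2 * k) ^ 2 by field_simp, sqrt_sq (by positivity)]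
      _ = _ := hb2.symm
  have main := volume_ellipse_collar hb hba hL hab
  set a := √(2 * k / l1)
  set b := √(2 * k / l2)
  let e := planeRotation c s hcs
  let E : Set (EuclideanSpace ℝ (Fin 2)) := {x | x 0 ^ 2 / a ^ 2 + x 1 ^ 2 / b ^ 2 < 1}
  have hform (x : EuclideanSpace ℝ (Fin 2)) : qA A (e x) < k ↔ x ∈ E := by
    have : qA A (e x) = k * (x 0 ^ 2 / a ^ 2 + x 1 ^ 2 / b ^ 2) := by
      simp only [qA, e, planeRotation_apply, ha2, hb2]
      simp [Matrix.mulVec, dotProduct, Fin.sum_univ_two, h00, h01, h10, h11]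
      field_simp
      linear_combination (c ^ 2 + s ^ 2 + 1) * (l1 * x 0 ^ 2 + l2 * x 1 ^ 2) * hcs
    rw [this]
    exact mul_lt_iff_lt_one_right hk
  have hE : Etilde A k = e '' E := by
    ext y
    obtain ⟨x, rfl⟩ := e.surjective y
    rw [e.injective.mem_set_image, ← hform]
    rfl
  have hfr : frontier (Etilde A k) = e '' frontier E := by
    rw [hE]; exact (e.toHomeomorph.image_frontier E).symm
  rw [← e.measurePreserving.measure_preimage_equiv (f := e.toMeasurableEquiv)]
  have hpre : e.toMeasurableEquiv ⁻¹'
      {x ∈ Etilde A k | Metric.infDist x (frontier (Etilde A k)) < L} =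
      {x | x ∈ E ∧ Metric.infDist x (frontier E) < L} := by
    ext x
    change (qA A (e x) < k ∧ Metric.infDist (e x) (frontier (Etilde A k)) < L) ↔ _
    rw [hform, hfr, Metric.infDist_image e.isometry]
    rfl
  rw [hpre, frontier_ellipse, circEllipse, ← ha2, ← hb2]
  exact main
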